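/- arXiv:2205.10177 — 2 statements merged into one kernel-verified Lean document; each statement's English description precedes it below -/
import Mathlib

section
/- For ν ∈ ℝ, the differential equation −v''(x) − 2·sech²(x)·v(x) = ν·sech²(x)·v(x) on ℝ admits a nonzero bounded solution v ∈ C²(ℝ; ℝ) if and only if ν = n(n+1) − 2 for some nonnegative integer n, i.e. if and only if ν ∈ {−2, 0, 4, 10, 18, …}. -/
open MeasureTheory Real Filter

open Polynomial Topology

theorem one_sub_tanh_sq (x : ℝ) : 1 - tanh x ^ 2 = ((cosh x)⁻¹) ^ 2 := by
  have h := (cosh_pos x).ne'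
  rw [tanh_eq_sinh_div_cosh]
  field_simp
  linarith [cosh_sq x]

theorem hasDerivAt_tanh_one_sub_sq (x : ℝ) : HasDerivAt tanh (1 - tanh x ^ 2) x := by
  have h := (cosh_pos x).ne'
  have key := (hasDerivAt_sinh x).div (hasDerivAt_cosh x) h
  have e : tanh = sinh / cosh := by ext y; exact tanh_eq_sinh_div_cosh y
  rw [e]
  refine key.congr_deriv ?_
  rw [Pi.div_apply]
  field_simp

theorem hasDerivAt_eval_tanh (p : ℝ[X]) (x : ℝ) :
    HasDerivAt (fun y => p.eval (tanh y))
      ((derivative p * (1 - X ^ 2)).eval (tanh x)) x := by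
  have := (p.hasDerivAt (tanh x)).comp x (hasDerivAt_tanh_one_sub_sq x)
  simpa [Function.comp_def] using this

theorem continuous_tanh_real : Continuous tanh :=
  continuous_iff_continuousAt.2 fun x => (hasDerivAt_tanh_one_sub_sq x).continuousAt

theorem one_sub_tanh_sq_le_inv (x : ℝ) : 1 - tanh x ^ 2 ≤ (1 + x ^ 2)⁻¹ := by
  rw [one_sub_tanh_sq, inv_pow]
  refine inv_anti₀ (by positivity) ?_
  have h : x ^ 2 ≤ sinh x ^ 2 := by
    rcases le_total 0 x with hx | hx
    · nlinarith [self_le_sinh_iff.2 hx]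
    · nlinarith [sinh_le_self_iff.2 hx]
  linarith [cosh_sq x]

theorem integrable_one_sub_tanh_sq : Integrable fun x : ℝ => 1 - tanh x ^ 2 := by
  refine integrable_inv_one_add_sq.mono'
    ((continuous_const.sub (continuous_tanh_real.pow 2)).aestronglyMeasurable)
    (Eventually.of_forall fun x => ?_)
  rw [norm_of_nonneg (sub_pos.2 (tanh_sq_lt_one x)).le]
  exact one_sub_tanh_sq_le_inv x

/-- The operator `q ↦ (1 - X²) q'' - 2 X q' + μ q` of Legendre's equation. -/
noncomputable def legendreOp (μ : ℝ) (q : ℝ[X]) : ℝ[X] :=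
  (1 - X ^ 2) * derivative (derivative q) - 2 * X * derivative q + C μ * q

theorem legendreOp_X {μ : ℝ} :
    legendreOp μ (X ^ 1) = C (μ - (1 : ℕ) * ((1 : ℕ) + 1)) * X ^ 1 + C 0 * 0 := by
  refine Polynomial.funext fun t => ?_
  simp [legendreOp]
  ring

theorem legendreOp_X_pow {μ : ℝ} (m : ℕ) :
    legendreOp μ (X ^ (m + 2))
      = C (μ - (m + 2 : ℕ) * ((m + 2 : ℕ) + 1)) * X ^ (m + 2)
        + C (((m : ℝ) + 2) * (m + 1)) * X ^ m := by
  refine Polynomial.funext fun t => ?_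
  simp [legendreOp]
  ring

theorem iterate_derivative_X_sq_sub_one_pow (n k : ℕ) :
    ((X : ℝ[X]) ^ 2 - 1) * derivative^[k + 2] ((X ^ 2 - 1) ^ n)
      + 2 * ((k : ℝ[X]) + 1) * X * derivative^[k + 1] ((X ^ 2 - 1) ^ n)
      + (k : ℝ[X]) * ((k : ℝ[X]) + 1) * derivative^[k] ((X ^ 2 - 1) ^ n)
      = 2 * (n : ℝ[X]) * X * derivative^[k + 1] ((X ^ 2 - 1) ^ n)
      + 2 * (n : ℝ[X]) * ((k : ℝ[X]) + 1) * derivative^[k] ((X ^ 2 - 1) ^ n) := by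
  have hC2 : (C 2 : ℝ[X]) = 2 := rfl
  induction k with
  | zero =>
    have h : ((X : ℝ[X]) ^ 2 - 1) * derivative ((X ^ 2 - 1) ^ n)
        = 2 * (n : ℝ[X]) * X * (X ^ 2 - 1) ^ n := by
      cases n with
      | zero => simp
      | succ m =>
        simp [derivative_pow, hC2]
        ring
    have h2 := congrArg derivative h
    simp only [derivative_mul, derivative_sub, derivative_X_pow, derivative_one,
      derivative_natCast, derivative_ofNat, derivative_X] at h2
    simp only [Function.iterate_succ', Function.iterate_zero, Function.comp_apply, id]
    simp [hC2] at h2 ⊢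
    linear_combination h2
  | succ k ih =>
    have h2 := congrArg derivative ih
    simp only [derivative_add, derivative_mul, derivative_sub, derivative_X_pow, derivative_one,
      derivative_natCast, derivative_ofNat, derivative_X, ← Function.iterate_succ_apply'] at h2
    simp [hC2] at h2 ⊢
    linear_combination h2

theorem exists_legendreOp_eq_zero (n : ℕ) :
    ∃ p : ℝ[X], p ≠ 0 ∧ legendreOp ((n : ℝ) * (n + 1)) p = 0 := by
  refine ⟨derivative^[n] ((X ^ 2 - 1) ^ n), fun h => ?_, ?_⟩
  · have hm : ((X : ℝ[X]) ^ 2 - 1).Monic := by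
      simpa using monic_X_pow_sub_C (1 : ℝ) two_ne_zero
    have hd : (((X : ℝ[X]) ^ 2 - 1) ^ n).natDegree = n + n := by
      have : ((X : ℝ[X]) ^ 2 - 1).natDegree = 2 := by
        simpa using natDegree_X_pow_sub_C (n := 2) (r := (1 : ℝ))
      rw [hm.natDegree_pow, this]
      ring
    have hc := congrArg (fun q => q.coeff n) h
    have h1 : (((X : ℝ[X]) ^ 2 - 1) ^ n).coeff (n + n) = 1 := by
      rw [← hd]
      exact (hm.pow n).coeff_natDegree
    simp only [coeff_iterate_derivative, h1, coeff_zero, nsmul_eq_mul, mul_one] at hc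
    norm_cast at hc
    rw [Nat.descFactorial_eq_zero_iff_lt] at hc
    omega
  · have h := iterate_derivative_X_sq_sub_one_pow n n
    rw [Function.iterate_succ_apply', Function.iterate_succ_apply'] at h
    simp only [legendreOp, map_mul, map_add, map_natCast, map_one]
    linear_combination -h

theorem tendsto_deriv_atTop_zero_of_bounded {v v' : ℝ → ℝ} {M L : ℝ}
    (hv : ∀ x, HasDerivAt v (v' x) x) (hM : ∀ x, |v x| ≤ M) (hL : Tendsto v' atTop (𝓝 L)) :
    Tendsto v' atTop (𝓝 0) := by
  have hex : ∀ x : ℝ, ∃ c, 0 < x → x < c ∧ v' c = (v (2 * x) - v x) / x := by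
    intro x
    by_cases hx : 0 < x
    · obtain ⟨c, hc, h⟩ := exists_hasDerivAt_eq_slope v v' (a := x) (b := 2 * x) (by linarith)
        (fun y _ => (hv y).continuousAt.continuousWithinAt) (fun y _ => hv y)
      exact ⟨c, fun _ => ⟨hc.1, by rw [h]; congr 1; ring⟩⟩
    · exact ⟨0, fun h => absurd h hx⟩
  choose c hc using hex
  have hcT : Tendsto c atTop atTop :=
    tendsto_atTop_mono' _ ((eventually_gt_atTop 0).mono fun x hx => (hc x hx).1.le) tendsto_id
  have h0 : Tendsto (fun x => v' (c x)) atTop (𝓝 0) := by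
    refine squeeze_zero_norm' ((eventually_gt_atTop 0).mono fun x hx => ?_)
      (tendsto_const_nhds.div_atTop tendsto_id : Tendsto (fun x : ℝ => (2 * M) / x) atTop (𝓝 0))
    rw [(hc x hx).2, norm_eq_abs, abs_div, abs_of_pos hx]
    gcongr
    have := abs_sub (v (2 * x)) (v x)
    linarith [hM x, hM (2 * x)]
  rwa [tendsto_nhds_unique (hL.comp hcT) h0] at hL

theorem abs_tanh_le_one (x : ℝ) : |tanh x| ≤ 1 := (abs_tanh_lt_one x).le

theorem tanh_mem_Icc (x : ℝ) : tanh x ∈ Set.Icc (-1 : ℝ) 1 := abs_le.1 (abs_tanh_le_one x)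

theorem exists_abs_eval_tanh_le (q : ℝ[X]) : ∃ K : ℝ, ∀ x, |q.eval (tanh x)| ≤ K := by
  obtain ⟨K, hK⟩ := isCompact_Icc.exists_bound_of_continuousOn
    (q.continuous.continuousOn (s := Set.Icc (-1 : ℝ) 1))
  exact ⟨K, fun x => hK _ (tanh_mem_Icc x)⟩

section BoundedSolution

variable {v v' : ℝ → ℝ} {M μ : ℝ}

theorem integrable_tanh_weight_mul_eval (hc : Continuous v) (hM : ∀ x, |v x| ≤ M) (q : ℝ[X]) :
    Integrable fun x => (1 - tanh x ^ 2) * (v x * q.eval (tanh x)) := by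
  obtain ⟨K, hK⟩ := exists_abs_eval_tanh_le q
  refine integrable_one_sub_tanh_sq.mul_bdd (c := M * K)
    ((hc.mul (q.continuous.comp continuous_tanh_real)).aestronglyMeasurable)
    (Eventually.of_forall fun x => ?_)
  rw [norm_mul]
  exact mul_le_mul (hM x) (hK x) (abs_nonneg _) ((abs_nonneg _).trans (hM x))

theorem tendsto_deriv_zero_of_ode (hv : ∀ x, HasDerivAt v (v' x) x)
    (hv' : ∀ x, HasDerivAt v' (-(μ * (1 - tanh x ^ 2) * v x)) x) (hM : ∀ x, |v x| ≤ M) :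
    Tendsto v' atTop (𝓝 0) ∧ Tendsto v' atBot (𝓝 0) := by
  have hc : Continuous v := continuous_iff_continuousAt.2 fun x => (hv x).continuousAt
  have hI : Integrable fun x => -(μ * (1 - tanh x ^ 2) * v x) := by
    refine ((integrable_tanh_weight_mul_eval hc hM 1).const_mul (-μ)).congr
      (Eventually.of_forall fun x => ?_)
    simp
    ring
  constructor
  · exact tendsto_deriv_atTop_zero_of_bounded hv hM
      (tendsto_limUnder_of_hasDerivAt_of_integrableOn_Ioi (a := 0) (fun x _ => hv' x)
        hI.integrableOn)
  · have hbot := tendsto_limUnder_of_hasDerivAt_of_integrableOn_Iic (a := 0) (fun x _ => hv' x)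
      hI.integrableOn
    have hneg : ∀ x, HasDerivAt (fun y => v (-y)) (-v' (-x)) x := fun x => by
      simpa [Function.comp_def] using (hv (-x)).comp x (hasDerivAt_neg x)
    have := tendsto_deriv_atTop_zero_of_bounded hneg (fun x => hM (-x))
      (hbot.comp tendsto_neg_atTop_atBot).neg
    have h2 := (this.comp tendsto_neg_atBot_atTop).neg
    simpa [Function.comp_def] using h2

theorem integral_tanh_weight_mul_legendreOp (hv : ∀ x, HasDerivAt v (v' x) x)
    (hv' : ∀ x, HasDerivAt v' (-(μ * (1 - tanh x ^ 2) * v x)) x) (hM : ∀ x, |v x| ≤ M)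
    (q : ℝ[X]) :
    ∫ x, (1 - tanh x ^ 2) * (v x * (legendreOp μ q).eval (tanh x)) = 0 := by
  have hc : Continuous v := continuous_iff_continuousAt.2 fun x => (hv x).continuousAt
  obtain ⟨htop, hbot⟩ := tendsto_deriv_zero_of_ode hv hv' hM
  obtain ⟨K, hK⟩ := exists_abs_eval_tanh_le q
  obtain ⟨K', hK'⟩ := exists_abs_eval_tanh_le (derivative q)
  have tanh_lim : ∀ l : Filter ℝ, Tendsto (fun x : ℝ => x ^ 2) l atTop →
      Tendsto (fun x : ℝ => 1 - tanh x ^ 2) l (𝓝 0) := by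
    intro l hl
    exact squeeze_zero (fun x => (sub_pos.2 (tanh_sq_lt_one x)).le) one_sub_tanh_sq_le_inv
      (tendsto_inv_atTop_zero.comp (tendsto_atTop_add_const_left l 1 hl))
  have lim : ∀ l : Filter ℝ, Tendsto (fun x : ℝ => x ^ 2) l atTop → Tendsto v' l (𝓝 0) →
      Tendsto (fun x => v x * (derivative q * (1 - X ^ 2)).eval (tanh x)
        - v' x * q.eval (tanh x)) l (𝓝 0) := by
    intro l hl hl'
    have h1 : Tendsto (fun x => M * K' * (1 - tanh x ^ 2) + |v' x| * K) l (𝓝 0) := by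
      simpa using ((tanh_lim l hl).const_mul (M * K')).add (hl'.abs.mul_const K)
    refine squeeze_zero_norm (fun x => ?_) h1
    refine (norm_sub_le _ _).trans (add_le_add ?_ ?_)
    · simp only [eval_mul, eval_sub, eval_one, eval_pow, eval_X, norm_mul, norm_eq_abs]
      rw [abs_of_pos (sub_pos.2 (tanh_sq_lt_one x)), ← mul_assoc]
      have := (abs_nonneg _).trans (hM x)
      have := (sub_pos.2 (tanh_sq_lt_one x)).le
      gcongr
      · exact hM x
      · exact hK' x
    · rw [norm_mul]
      exact mul_le_mul_of_nonneg_left (hK x) (abs_nonneg _)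
  have h := integral_of_hasDerivAt_of_tendsto (m := (0 : ℝ)) (n := 0)
    (f := fun x => v x * (derivative q * (1 - X ^ 2)).eval (tanh x) - v' x * q.eval (tanh x))
    (f' := fun x => (1 - tanh x ^ 2) * (v x * (legendreOp μ q).eval (tanh x)))
    (fun x => ?_) (integrable_tanh_weight_mul_eval hc hM _)
    (lim _ (by simpa [Function.comp_def] using
      (tendsto_pow_atTop (α := ℝ) two_ne_zero).comp tendsto_neg_atBot_atTop) hbot)
    (lim _ (tendsto_pow_atTop two_ne_zero) htop)
  · simpa using h
  · refine (((hv x).mul (hasDerivAt_eval_tanh (derivative q * (1 - X ^ 2)) x)).sub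
      ((hv' x).mul (hasDerivAt_eval_tanh q x))).congr_deriv ?_
    simp [legendreOp]
    ring

theorem integral_tanh_weight_mul_eval_eq_zero (hv : ∀ x, HasDerivAt v (v' x) x)
    (hv' : ∀ x, HasDerivAt v' (-(μ * (1 - tanh x ^ 2) * v x)) x) (hM : ∀ x, |v x| ≤ M)
    (hμ : ∀ n : ℕ, μ ≠ (n : ℝ) * (n + 1)) (q : ℝ[X]) :
    ∫ x, (1 - tanh x ^ 2) * (v x * q.eval (tanh x)) = 0 := by
  have hc : Continuous v := continuous_iff_continuousAt.2 fun x => (hv x).continuousAt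
  have hadd : ∀ p r : ℝ[X], ∫ x, (1 - tanh x ^ 2) * (v x * (p + r).eval (tanh x))
      = (∫ x, (1 - tanh x ^ 2) * (v x * p.eval (tanh x)))
        + ∫ x, (1 - tanh x ^ 2) * (v x * r.eval (tanh x)) := by
    intro p r
    rw [← integral_add (integrable_tanh_weight_mul_eval hc hM p)
      (integrable_tanh_weight_mul_eval hc hM r)]
    congr 1 with x
    simp
    ring
  have hsmul : ∀ (a : ℝ) (p : ℝ[X]), ∫ x, (1 - tanh x ^ 2) * (v x * (C a * p).eval (tanh x))
      = a * ∫ x, (1 - tanh x ^ 2) * (v x * p.eval (tanh x)) := by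
    intro a p
    rw [← integral_const_mul]
    congr 1 with x
    simp
    ring
  have hpow : ∀ n : ℕ, ∫ x, (1 - tanh x ^ 2) * (v x * (X ^ n : ℝ[X]).eval (tanh x)) = 0 := by
    intro n
    induction n using Nat.strong_induction_on with
    | _ n ih =>
      have hL := integral_tanh_weight_mul_legendreOp hv hv' hM (X ^ n)
      have hn := sub_ne_zero.2 (hμ n)
      obtain ⟨a, p, hp, hpz⟩ : ∃ (a : ℝ) (p : ℝ[X]),
          legendreOp μ (X ^ n) = C (μ - n * (n + 1)) * X ^ n + C a * p ∧
            ∫ x, (1 - tanh x ^ 2) * (v x * p.eval (tanh x)) = 0 := by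
        obtain rfl | rfl | ⟨m, rfl⟩ : n = 0 ∨ n = 1 ∨ ∃ m, n = m + 2 := by
          rcases n with _ | _ | m <;> simp
        · exact ⟨0, 0, by simp [legendreOp], by simp⟩
        · exact ⟨0, 0, legendreOp_X, by simp⟩
        · exact ⟨(m + 2) * (m + 1), X ^ m, legendreOp_X_pow m, ih m (by omega)⟩
      rw [hp, hadd, hsmul, hsmul, hpz, mul_zero, add_zero] at hL
      exact (mul_eq_zero.1 hL).resolve_left hn
  induction q using Polynomial.induction_on' with
  | add p r hp hr => rw [hadd, hp, hr, add_zero]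
  | monomial n a => rw [← C_mul_X_pow_eq_monomial, hsmul, hpow, mul_zero]

end BoundedSolution

theorem continuousAt_artanh {t : ℝ} (ht : t ∈ Set.Ioo (-1 : ℝ) 1) : ContinuousAt artanh t := by
  have h1 : 1 - t ≠ 0 := by linarith [ht.2]
  have h2 : 0 < (1 + t) / (1 - t) := div_pos (by linarith [ht.1]) (by linarith [ht.2])
  unfold artanh
  exact (((continuousAt_const.add continuousAt_id).div (continuousAt_const.sub continuousAt_id)
    h1).sqrt).log (Real.sqrt_pos.2 h2).ne'

theorem continuous_one_sub_sq_mul_comp_artanh {v : ℝ → ℝ} {M : ℝ} (hc : Continuous v)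
    (hM : ∀ x, |v x| ≤ M) :
    ContinuousOn (fun t => (1 - t ^ 2) * v (artanh t)) (Set.Icc (-1 : ℝ) 1) := by
  intro t ht
  by_cases h : t ∈ Set.Ioo (-1 : ℝ) 1
  · exact ((continuousAt_const.sub (continuousAt_id.pow 2)).mul
      (hc.continuousAt.comp (continuousAt_artanh h))).continuousWithinAt
  · have h1 : 1 - t ^ 2 = 0 := by
      rcases ht.1.eq_or_lt with h2 | h2
      · rw [← h2]; norm_num
      · rcases ht.2.eq_or_lt with h3 | h3
        · rw [h3]; norm_num
        · exact absurd ⟨h2, h3⟩ h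
    refine ContinuousAt.continuousWithinAt ?_
    have h2 : Tendsto (fun s : ℝ => |1 - s ^ 2| * M) (𝓝 t) (𝓝 0) := by
      have : Continuous fun s : ℝ => |1 - s ^ 2| * M := by fun_prop
      simpa [h1] using this.tendsto t
    unfold ContinuousAt
    simp only [h1, zero_mul]
    refine squeeze_zero_norm (fun s => ?_) h2
    rw [norm_mul]
    exact mul_le_mul_of_nonneg_left (hM _) (abs_nonneg _)

theorem eq_zero_of_integral_tanh_weight_mul_eval_eq_zero {v : ℝ → ℝ} {M : ℝ} (hc : Continuous v)
    (hM : ∀ x, |v x| ≤ M)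
    (h : ∀ q : ℝ[X], ∫ x, (1 - tanh x ^ 2) * (v x * q.eval (tanh x)) = 0) : v = 0 := by
  set w : ℝ → ℝ := fun x => (1 - tanh x ^ 2) * v x with hw
  have hwc : Continuous w := (continuous_const.sub (continuous_tanh_real.pow 2)).mul hc
  have hwI : Integrable w := by
    simpa using integrable_tanh_weight_mul_eval hc hM 1
  have hwM : ∀ x, ‖w x‖ ≤ M := fun x => by
    have h1 := tanh_sq_lt_one x
    rw [hw, norm_mul, norm_of_nonneg (sub_pos.2 h1).le]
    exact (mul_le_of_le_one_left (norm_nonneg _) (by linarith [sq_nonneg (tanh x)])).trans (hM x)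
  have hw2I : Integrable fun x => w x * w x :=
    hwI.mul_bdd (c := M) hwc.aestronglyMeasurable (Eventually.of_forall hwM)
  have hle : ∀ ε > 0, ∫ x, w x * w x ≤ ε * ∫ x, |w x| := by
    intro ε hε
    obtain ⟨q, hq⟩ := exists_polynomial_near_of_continuousOn (-1) 1 _
      (continuous_one_sub_sq_mul_comp_artanh hc hM) ε hε
    have hqI := integrable_tanh_weight_mul_eval hc hM q
    calc ∫ x, w x * w x
        = ∫ x, (w x * w x - (1 - tanh x ^ 2) * (v x * q.eval (tanh x))) := by
          rw [integral_sub hw2I hqI, h q, sub_zero]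
      _ ≤ ∫ x, ε * |w x| := by
          refine integral_mono (hw2I.sub hqI) (hwI.abs.const_mul ε) fun x => ?_
          have hx := hq _ (tanh_mem_Icc x)
          simp only [artanh_tanh] at hx
          have : w x * w x - (1 - tanh x ^ 2) * (v x * q.eval (tanh x))
              = -(w x * (q.eval (tanh x) - (1 - tanh x ^ 2) * v x)) := by
            simp only [hw]; ring
          simp only [this]
          refine (neg_le_abs _).trans ?_
          rw [abs_mul, mul_comm]
          exact mul_le_mul_of_nonneg_right hx.le (abs_nonneg _)
      _ = ε * ∫ x, |w x| := integral_const_mul _ _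
  have hzero : ∫ x, w x * w x ≤ 0 := by
    have hlim : Tendsto (fun ε : ℝ => ε * ∫ x, |w x|) (𝓝[>] 0) (𝓝 0) := by
      have : Continuous fun ε : ℝ => ε * ∫ x, |w x| := by fun_prop
      simpa using (this.tendsto 0).mono_left nhdsWithin_le_nhds
    exact ge_of_tendsto hlim (eventually_mem_nhdsWithin.mono fun ε hε => hle ε hε)
  ext x
  by_contra hx
  have hwx : w x * w x ≠ 0 :=
    mul_self_ne_zero.2 (mul_ne_zero (sub_pos.2 (tanh_sq_lt_one x)).ne' hx)
  exact hzero.not_gt (integral_pos_of_integrable_nonneg_nonzero (hwc.mul hwc) hw2I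
    (fun y => mul_self_nonneg _) hwx)

/-- The spectral problem `-v'' - 2 sech² v = ν sech² v` admits a nonzero bounded `C²`
solution on `ℝ` if and only if `ν = n(n+1) - 2` for some `n ∈ ℕ`. -/
theorem stmt_7 (ν : ℝ) :
    (∃ v : ℝ → ℝ, ContDiff ℝ 2 v ∧ v ≠ 0 ∧ (∃ M : ℝ, ∀ x, |v x| ≤ M) ∧
      ∀ x : ℝ, -(deriv (deriv v) x) - 2 * ((Real.cosh x)⁻¹)^2 * v x
        = ν * ((Real.cosh x)⁻¹)^2 * v x) ↔
    ∃ n : ℕ, ν = (n : ℝ) * ((n : ℝ) + 1) - 2 := by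
  constructor
  · rintro ⟨v, hC, hne, ⟨M, hM⟩, hode⟩
    by_contra! hn
    have hv : ∀ x, HasDerivAt v (deriv v x) x :=
      fun x => (hC.differentiable two_ne_zero x).hasDerivAt
    have hC1 : ContDiff ℝ 1 (deriv v) := (contDiff_succ_iff_deriv (n := 1).1 hC).2.2
    have hv' : ∀ x, HasDerivAt (deriv v) (-((ν + 2) * (1 - tanh x ^ 2) * v x)) x := fun x => by
      refine (hC1.differentiable one_ne_zero x).hasDerivAt.congr_deriv ?_
      rw [one_sub_tanh_sq]
      linarith [hode x]
    exact hne (eq_zero_of_integral_tanh_weight_mul_eval_eq_zero hC.continuous hM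
      (integral_tanh_weight_mul_eval_eq_zero hv hv' hM fun n h => hn n (by linarith)))
  · rintro ⟨n, rfl⟩
    obtain ⟨p, hp, hL⟩ := exists_legendreOp_eq_zero n
    have hd : ∀ q : ℝ[X], deriv (fun x => q.eval (tanh x))
        = fun x => (derivative q * (1 - X ^ 2)).eval (tanh x) :=
      fun q => funext fun x => (hasDerivAt_eval_tanh q x).deriv
    have hT : ContDiff ℝ 2 tanh := by
      have e : tanh = fun x => sinh x / cosh x := funext tanh_eq_sinh_div_cosh
      rw [e]
      exact contDiff_sinh.div contDiff_cosh fun x => (cosh_pos x).ne'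
    refine ⟨fun x => p.eval (tanh x), (by simpa [coe_aeval_eq_eval] using p.contDiff_aeval (𝕜 := ℝ) 2 : ContDiff ℝ 2 fun t => p.eval t).comp hT, fun h => hp ?_,
      exists_abs_eval_tanh_le p, fun x => ?_⟩
    · refine p.eq_zero_of_infinite_isRoot ((Set.Ioo_infinite (a := (-1 : ℝ)) (b := 1)
        (by norm_num)).mono fun t ht => ?_)
      simpa [tanh_artanh ht] using congrFun h (artanh t)
    · have hx := congrArg (fun q => q.eval (tanh x)) hL
      rw [hd, hd, ← one_sub_tanh_sq]
      simp [legendreOp] at hx ⊢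
      linear_combination -(1 - tanh x ^ 2) * hx
end

section
/- Let I ⊆ ℝ be an open interval and let ψ: I × ℝ → ℂ be smooth and solve i·(1 − |ψ|²)·∂_tψ + ∂_x²ψ = 0 on I × ℝ. Suppose there exist constants α > 0 and 0 < C₁ ≤ C₂ such that for all (t,x) ∈ I × ℝ: |ψ(t,x)| < 1, C₁·e^{−α|x|} ≤ 1 − |ψ(t,x)|² ≤ C₂·e^{−α|x|}, and |∂_xψ(t,x)| + |∂_x²ψ(t,x)| + |∂_x³ψ(t,x)| ≤ C₂·e^{−α|x|}. Then both the mass M(t) := ∫_ℝ (1 − |ψ(t,x)|²)² dx and the energy E(t) := ∫_ℝ |∂_xψ(t,x)|² dx are finite and constant in t on I. -/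
open MeasureTheory Real Filter

open scoped Topology InnerProductSpace

lemma integrable_exp_neg_mul_abs {α : ℝ} (hα : 0 < α) :
    Integrable (fun x : ℝ => Real.exp (-α * |x|)) := by
  rw [← integrableOn_univ, ← Set.Iic_union_Ioi (a := (0 : ℝ)), integrableOn_union]
  constructor
  · refine (integrableOn_exp_mul_Iic hα 0).congr_fun (fun x hx => ?_) measurableSet_Iic
    simp [abs_of_nonpos (Set.mem_Iic.1 hx)]
  · refine (integrableOn_exp_mul_Ioi (neg_lt_zero.2 hα) 0).congr_fun (fun x hx => ?_)
      measurableSet_Ioi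
    simp [abs_of_pos (Set.mem_Ioi.1 hx)]

lemma tendsto_zero_of_abs_le_exp_neg_mul_abs {α K : ℝ} (hα : 0 < α) {F : ℝ → ℝ}
    (hF : ∀ x, |F x| ≤ K * Real.exp (-α * |x|)) {l : Filter ℝ}
    (hl : Tendsto (fun x : ℝ => |x|) l atTop) : Tendsto F l (𝓝 0) := by
  refine squeeze_zero_norm (fun x => hF x) ?_
  have h : Tendsto (fun x : ℝ => -α * |x|) l atBot := hl.const_mul_atTop_of_neg (by linarith)
  simpa using (Real.tendsto_exp_atBot.comp h).const_mul K

/-- A density `f` with `∂ₜ f = ∂ₓ F` whose flux `F` and time derivative `g` decay exponentially,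
uniformly in time, has constant integral. -/
lemma integral_eq_of_exp_decaying_flux {I : Set ℝ} (hI : IsOpen I) (hIc : I.OrdConnected)
    {f g F : ℝ → ℝ → ℝ} {α K : ℝ} (hα : 0 < α)
    (hft : ∀ t ∈ I, ∀ x, HasDerivAt (fun τ => f τ x) (g t x) t)
    (hFx : ∀ t ∈ I, ∀ x, HasDerivAt (F t) (g t x) x)
    (hf : ∀ t ∈ I, Integrable (f t))
    (hgc : ∀ t ∈ I, Continuous (g t))
    (hg : ∀ t ∈ I, ∀ x, |g t x| ≤ K * Real.exp (-α * |x|))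
    (hF : ∀ t ∈ I, ∀ x, |F t x| ≤ K * Real.exp (-α * |x|)) :
    ∀ t₁ ∈ I, ∀ t₂ ∈ I, ∫ x, f t₁ x = ∫ x, f t₂ x := by
  have key : ∀ t ∈ I, HasDerivAt (fun τ => ∫ x, f τ x) 0 t := by
    intro t ht
    have hIt : I ∈ 𝓝 t := hI.mem_nhds ht
    obtain ⟨hint, hder⟩ := hasDerivAt_integral_of_dominated_loc_of_deriv_le (μ := volume)
      (bound := fun x => K * Real.exp (-α * |x|)) hIt
      (Filter.mem_of_superset hIt fun τ hτ => (hf τ hτ).aestronglyMeasurable) (hf t ht)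
      (hgc t ht).aestronglyMeasurable (ae_of_all _ fun x τ hτ => hg τ hτ x)
      ((integrable_exp_neg_mul_abs hα).const_mul K) (ae_of_all _ fun x τ hτ => hft τ hτ x)
    have hzero : ∫ x, g t x = 0 - 0 := integral_of_hasDerivAt_of_tendsto (hFx t ht) hint
      (tendsto_zero_of_abs_le_exp_neg_mul_abs hα (hF t ht) tendsto_abs_atBot_atTop)
      (tendsto_zero_of_abs_le_exp_neg_mul_abs hα (hF t ht) tendsto_abs_atTop_atTop)
    rwa [hzero, sub_zero] at hder
  intro t₁ h₁ t₂ h₂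
  exact hI.is_const_of_deriv_eq_zero hIc.isPreconnected
    (fun t ht => (key t ht).differentiableAt.differentiableWithinAt)
    (fun t ht => (key t ht).deriv) h₁ h₂

section PartialDerivatives

variable {E : Type*} [NormedAddCommGroup E] [NormedSpace ℝ E] {I : Set ℝ} {φ : ℝ → ℝ → E}

lemma hasDerivAt_prodMk_const (t x : ℝ) :
    HasDerivAt (fun τ : ℝ => (τ, x)) ((1, 0) : ℝ × ℝ) t :=
  (hasDerivAt_id t).prodMk (hasDerivAt_const t x)

lemma hasDerivAt_const_prodMk (t x : ℝ) :
    HasDerivAt (fun y : ℝ => (t, y)) ((0, 1) : ℝ × ℝ) x :=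
  (hasDerivAt_const x t).prodMk (hasDerivAt_id x)

lemma isOpen_prod_univ (hI : IsOpen I) : IsOpen (I ×ˢ (Set.univ : Set ℝ)) := hI.prod isOpen_univ

lemma ContDiffOn.hasFDerivAt_uncurry (hI : IsOpen I)
    (h : ContDiffOn ℝ (⊤ : ℕ∞) (Function.uncurry φ) (I ×ˢ (Set.univ : Set ℝ)))
    {t : ℝ} (ht : t ∈ I) (x : ℝ) :
    HasFDerivAt (Function.uncurry φ) (fderiv ℝ (Function.uncurry φ) (t, x)) (t, x) :=
  ((h.contDiffAt ((isOpen_prod_univ hI).mem_nhds ⟨ht, trivial⟩)).differentiableAt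
    (by simp)).hasFDerivAt

lemma ContDiffOn.hasDerivAt_snd (hI : IsOpen I)
    (h : ContDiffOn ℝ (⊤ : ℕ∞) (Function.uncurry φ) (I ×ˢ (Set.univ : Set ℝ)))
    {t : ℝ} (ht : t ∈ I) (x : ℝ) :
    HasDerivAt (φ t) (fderiv ℝ (Function.uncurry φ) (t, x) (0, 1)) x :=
  (h.hasFDerivAt_uncurry hI ht x).comp_hasDerivAt x (hasDerivAt_const_prodMk t x)

lemma ContDiffOn.hasDerivAt_fst (hI : IsOpen I)
    (h : ContDiffOn ℝ (⊤ : ℕ∞) (Function.uncurry φ) (I ×ˢ (Set.univ : Set ℝ)))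
    {t : ℝ} (ht : t ∈ I) (x : ℝ) :
    HasDerivAt (fun τ => φ τ x) (fderiv ℝ (Function.uncurry φ) (t, x) (1, 0)) t :=
  HasFDerivAt.comp_hasDerivAt (l := Function.uncurry φ) (f := fun τ => (τ, x)) t
    (h.hasFDerivAt_uncurry hI ht x) (hasDerivAt_prodMk_const t x)

lemma ContDiffOn.fderiv_uncurry_apply (hI : IsOpen I)
    (h : ContDiffOn ℝ (⊤ : ℕ∞) (Function.uncurry φ) (I ×ˢ (Set.univ : Set ℝ))) (v : ℝ × ℝ) :
    ContDiffOn ℝ (⊤ : ℕ∞) (fun p => fderiv ℝ (Function.uncurry φ) p v)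
      (I ×ˢ (Set.univ : Set ℝ)) :=
  (h.fderiv_of_isOpen (isOpen_prod_univ hI) (by simp)).clm_apply contDiffOn_const

lemma ContDiffOn.deriv_snd (hI : IsOpen I)
    (h : ContDiffOn ℝ (⊤ : ℕ∞) (Function.uncurry φ) (I ×ˢ (Set.univ : Set ℝ))) :
    ContDiffOn ℝ (⊤ : ℕ∞) (Function.uncurry fun t => deriv (φ t)) (I ×ˢ (Set.univ : Set ℝ)) :=
  (h.fderiv_uncurry_apply hI (0, 1)).congr fun p hp => (h.hasDerivAt_snd hI hp.1 p.2).deriv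

lemma ContDiffOn.deriv_fst (hI : IsOpen I)
    (h : ContDiffOn ℝ (⊤ : ℕ∞) (Function.uncurry φ) (I ×ˢ (Set.univ : Set ℝ))) :
    ContDiffOn ℝ (⊤ : ℕ∞) (Function.uncurry fun t x => deriv (fun τ => φ τ x) t)
      (I ×ˢ (Set.univ : Set ℝ)) :=
  (h.fderiv_uncurry_apply hI (1, 0)).congr fun p hp => (h.hasDerivAt_fst hI hp.1 p.2).deriv

lemma ContDiffOn.differentiableAt_snd (hI : IsOpen I)
    (h : ContDiffOn ℝ (⊤ : ℕ∞) (Function.uncurry φ) (I ×ˢ (Set.univ : Set ℝ)))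
    {t : ℝ} (ht : t ∈ I) (x : ℝ) : DifferentiableAt ℝ (φ t) x :=
  (h.hasDerivAt_snd hI ht x).differentiableAt

lemma ContDiffOn.differentiableAt_fst (hI : IsOpen I)
    (h : ContDiffOn ℝ (⊤ : ℕ∞) (Function.uncurry φ) (I ×ˢ (Set.univ : Set ℝ)))
    {t : ℝ} (ht : t ∈ I) (x : ℝ) : DifferentiableAt ℝ (fun τ => φ τ x) t :=
  (h.hasDerivAt_fst hI ht x).differentiableAt

lemma ContDiffOn.continuous_snd (hI : IsOpen I)
    (h : ContDiffOn ℝ (⊤ : ℕ∞) (Function.uncurry φ) (I ×ˢ (Set.univ : Set ℝ)))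
    {t : ℝ} (ht : t ∈ I) : Continuous (φ t) :=
  continuous_iff_continuousAt.2 fun x => (h.differentiableAt_snd hI ht x).continuousAt

lemma ContDiffOn.deriv_fst_deriv_snd_comm (hI : IsOpen I)
    (h : ContDiffOn ℝ (⊤ : ℕ∞) (Function.uncurry φ) (I ×ˢ (Set.univ : Set ℝ)))
    {t : ℝ} (ht : t ∈ I) (x : ℝ) :
    deriv (fun τ => deriv (φ τ) x) t = deriv (fun y => deriv (fun τ => φ τ y) t) x := by
  have hU := (isOpen_prod_univ hI).mem_nhds
    (show (t, x) ∈ I ×ˢ (Set.univ : Set ℝ) from ⟨ht, trivial⟩)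
  have hsymm := (h.contDiffAt hU).isSymmSndFDerivAt (n := (⊤ : ℕ∞))
    (by rw [minSmoothness_of_isRCLikeNormedField]
        exact WithTop.coe_le_coe.2 (le_top : (2 : ℕ∞) ≤ ⊤))
  have hD : HasFDerivAt (fderiv ℝ (Function.uncurry φ))
      (fderiv ℝ (fderiv ℝ (Function.uncurry φ)) (t, x)) (t, x) :=
    (((h.fderiv_of_isOpen (m := (⊤ : ℕ∞)) (isOpen_prod_univ hI) (by simp)).contDiffAt
      hU).differentiableAt (by simp)).hasFDerivAt
  have h₁ : HasDerivAt (fun τ => fderiv ℝ (Function.uncurry φ) (τ, x) (0, 1))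
      (fderiv ℝ (fderiv ℝ (Function.uncurry φ)) (t, x) (1, 0) (0, 1)) t :=
    ((ContinuousLinearMap.apply ℝ E ((0, 1) : ℝ × ℝ)).hasFDerivAt.comp_hasDerivAt t
      (hD.comp_hasDerivAt t (hasDerivAt_prodMk_const t x)))
  have h₂ : HasDerivAt (fun y => fderiv ℝ (Function.uncurry φ) (t, y) (1, 0))
      (fderiv ℝ (fderiv ℝ (Function.uncurry φ)) (t, x) (0, 1) (1, 0)) x :=
    ((ContinuousLinearMap.apply ℝ E ((1, 0) : ℝ × ℝ)).hasFDerivAt.comp_hasDerivAt x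
      (hD.comp_hasDerivAt x (hasDerivAt_const_prodMk t x)))
  have e₁ : (fun τ => deriv (φ τ) x) =ᶠ[𝓝 t]
      fun τ => fderiv ℝ (Function.uncurry φ) (τ, x) (0, 1) :=
    Filter.mem_of_superset (hI.mem_nhds ht) fun τ hτ => (h.hasDerivAt_snd hI hτ x).deriv
  have e₂ : (fun y => deriv (fun τ => φ τ y) t) =
      fun y => fderiv ℝ (Function.uncurry φ) (t, y) (1, 0) :=
    funext fun y => (h.hasDerivAt_fst hI ht y).deriv
  rw [e₁.deriv_eq, e₂, h₁.deriv, h₂.deriv]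
  exact hsymm _ _

end PartialDerivatives

/-- Conservation of mass `M(ψ) = ∫ (1-|ψ|²)² dx` and energy `E(ψ) = ∫ |ψ_x|² dx` for smooth
solutions of `i(1-|ψ|²)ψ_t + ψ_xx = 0` on an open interval `I` of times, with `|ψ| < 1`,
two-sided exponential control of `1-|ψ|²`, and exponential decay of the first three spatial
derivatives. -/
theorem stmt_19 (I : Set ℝ) (hIopen : IsOpen I) (hIconn : I.OrdConnected)
    (ψ : ℝ → ℝ → ℂ)
    (hsmooth : ContDiffOn ℝ (⊤ : ℕ∞) (Function.uncurry ψ) (I ×ˢ (Set.univ : Set ℝ)))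
    (α C₁ C₂ : ℝ) (hα : 0 < α) (hC₁ : 0 < C₁) (hC₁₂ : C₁ ≤ C₂)
    (hmod : ∀ t ∈ I, ∀ x : ℝ, ‖ψ t x‖ < 1)
    (hdecay : ∀ t ∈ I, ∀ x : ℝ,
      C₁ * Real.exp (-α * |x|) ≤ 1 - ‖ψ t x‖^2 ∧ 1 - ‖ψ t x‖^2 ≤ C₂ * Real.exp (-α * |x|))
    (hder : ∀ t ∈ I, ∀ x : ℝ,
      ‖deriv (ψ t) x‖ + ‖deriv (deriv (ψ t)) x‖ + ‖deriv (deriv (deriv (ψ t))) x‖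
        ≤ C₂ * Real.exp (-α * |x|))
    (hPDE : ∀ t ∈ I, ∀ x : ℝ,
      Complex.I * ((1 - ‖ψ t x‖^2 : ℝ) : ℂ) * deriv (fun τ => ψ τ x) t
        + deriv (deriv (ψ t)) x = 0) :
    (∀ t ∈ I, Integrable (fun x : ℝ => (1 - ‖ψ t x‖^2)^2) volume) ∧
    (∀ t ∈ I, Integrable (fun x : ℝ => ‖deriv (ψ t) x‖^2) volume) ∧
    (∀ t₁ ∈ I, ∀ t₂ ∈ I,
      (∫ x : ℝ, (1 - ‖ψ t₁ x‖^2)^2) = ∫ x : ℝ, (1 - ‖ψ t₂ x‖^2)^2) ∧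
    (∀ t₁ ∈ I, ∀ t₂ ∈ I,
      (∫ x : ℝ, ‖deriv (ψ t₁) x‖^2) = ∫ x : ℝ, ‖deriv (ψ t₂) x‖^2) := by
  set p : ℝ → ℝ → ℂ := fun t => deriv (ψ t) with hp
  set q : ℝ → ℝ → ℂ := fun t => deriv (p t) with hq
  set s : ℝ → ℝ → ℂ := fun t x => deriv (fun τ => ψ τ x) t with hs
  set m : ℝ → ℝ → ℂ := fun t => deriv (s t) with hm
  have sp := hsmooth.deriv_snd hIopen
  have sq := sp.deriv_snd hIopen
  have ss := hsmooth.deriv_fst hIopen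
  have sm := ss.deriv_snd hIopen
  have dψx : ∀ t ∈ I, ∀ x, HasDerivAt (ψ t) (p t x) x := fun t ht x =>
    (hsmooth.differentiableAt_snd hIopen ht x).hasDerivAt
  have dpx : ∀ t ∈ I, ∀ x, HasDerivAt (p t) (q t x) x := fun t ht x =>
    (sp.differentiableAt_snd hIopen ht x).hasDerivAt
  have dqx : ∀ t ∈ I, ∀ x, HasDerivAt (q t) (deriv (q t) x) x := fun t ht x =>
    (sq.differentiableAt_snd hIopen ht x).hasDerivAt
  have dsx : ∀ t ∈ I, ∀ x, HasDerivAt (s t) (m t x) x := fun t ht x =>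
    (ss.differentiableAt_snd hIopen ht x).hasDerivAt
  have dψt : ∀ t ∈ I, ∀ x, HasDerivAt (fun τ => ψ τ x) (s t x) t := fun t ht x =>
    (hsmooth.differentiableAt_fst hIopen ht x).hasDerivAt
  have dpt : ∀ t ∈ I, ∀ x, HasDerivAt (fun τ => p τ x) (m t x) t := fun t ht x => by
    have h := (sp.differentiableAt_fst hIopen ht x).hasDerivAt
    rwa [hsmooth.deriv_fst_deriv_snd_comm hIopen ht x] at h
  have cψ : ∀ t ∈ I, Continuous (ψ t) := fun t ht => hsmooth.continuous_snd hIopen ht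
  have cp : ∀ t ∈ I, Continuous (p t) := fun t ht => sp.continuous_snd hIopen ht
  have cq : ∀ t ∈ I, Continuous (q t) := fun t ht => sq.continuous_snd hIopen ht
  have cm : ∀ t ∈ I, Continuous (m t) := fun t ht => sm.continuous_snd hIopen ht
  have hC₂ : 0 < C₂ := hC₁.trans_le hC₁₂
  have bp : ∀ t ∈ I, ∀ x, ‖p t x‖ ≤ C₂ * Real.exp (-α * |x|) := fun t ht x => by
    linarith [hder t ht x, norm_nonneg (q t x), norm_nonneg (deriv (q t) x)]
  have bq : ∀ t ∈ I, ∀ x, ‖q t x‖ ≤ C₂ * Real.exp (-α * |x|) := fun t ht x => by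
    linarith [hder t ht x, norm_nonneg (p t x), norm_nonneg (deriv (q t) x)]
  have br : ∀ t ∈ I, ∀ x, ‖deriv (q t) x‖ ≤ C₂ * Real.exp (-α * |x|) := fun t ht x => by
    linarith [hder t ht x, norm_nonneg (p t x), norm_nonneg (q t x)]
  have epos : ∀ x : ℝ, 0 < Real.exp (-α * |x|) := fun x => Real.exp_pos _
  have ele : ∀ x : ℝ, Real.exp (-α * |x|) ≤ 1 := fun x =>
    Real.exp_le_one_iff.2 (by nlinarith [abs_nonneg x])
  have hws : ∀ t ∈ I, ∀ x, (1 - ‖ψ t x‖ ^ 2) • s t x = Complex.I * q t x := fun t ht x => by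
    have h := hPDE t ht x
    rw [Complex.real_smul]
    linear_combination (-Complex.I) * h + ((1 - ‖ψ t x‖ ^ 2 : ℝ) : ℂ) * s t x * Complex.I_sq
  have bs : ∀ t ∈ I, ∀ x, ‖s t x‖ ≤ C₂ / C₁ := fun t ht x => by
    have h := congrArg norm (hws t ht x)
    have hw := (hdecay t ht x).1
    rw [norm_smul, norm_mul, Complex.norm_I, one_mul, Real.norm_eq_abs,
      abs_of_nonneg (by nlinarith [epos x])] at h
    rw [le_div_iff₀ hC₁]
    refine le_of_mul_le_mul_right ?_ (epos x)
    nlinarith [bq t ht x, norm_nonneg (s t x), mul_le_mul_of_nonneg_right hw (norm_nonneg (s t x))]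
  have dwx : ∀ t ∈ I, ∀ x,
      HasDerivAt (fun y => 1 - ‖ψ t y‖ ^ 2) (-(2 * ⟪ψ t x, p t x⟫_ℝ)) x := fun t ht x =>
    (dψx t ht x).norm_sq.const_sub 1
  have bm : ∀ t ∈ I, ∀ x, ‖m t x‖ ≤ (C₂ + 2 * C₂ * (C₂ / C₁)) / C₁ := fun t ht x => by
    have h₁ := (dwx t ht x).smul (dsx t ht x)
    have h₂ : HasDerivAt (fun y => (1 - ‖ψ t y‖ ^ 2) • s t y) (Complex.I * deriv (q t) x) x := by
      simpa only [hws t ht] using (dqx t ht x).const_mul Complex.I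
    have h := h₁.unique h₂
    have hw := (hdecay t ht x).1
    have hn : (1 - ‖ψ t x‖ ^ 2) * ‖m t x‖
        ≤ ‖deriv (q t) x‖ + |2 * ⟪ψ t x, p t x⟫_ℝ| * ‖s t x‖ := by
      calc (1 - ‖ψ t x‖ ^ 2) * ‖m t x‖ = ‖(1 - ‖ψ t x‖ ^ 2) • m t x‖ := by
            rw [norm_smul, Real.norm_eq_abs, abs_of_nonneg (by nlinarith [epos x])]
        _ = ‖Complex.I * deriv (q t) x + (2 * ⟪ψ t x, p t x⟫_ℝ) • s t x‖ := by
            rw [← h, neg_smul, neg_add_cancel_right]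
        _ ≤ _ := (norm_add_le _ _).trans_eq (by
            rw [norm_mul, Complex.norm_I, one_mul, norm_smul, Real.norm_eq_abs])
    have hi : |2 * ⟪ψ t x, p t x⟫_ℝ| ≤ 2 * (C₂ * Real.exp (-α * |x|)) := by
      rw [abs_mul, abs_two]
      have := abs_real_inner_le_norm (ψ t x) (p t x)
      nlinarith [bp t ht x, hmod t ht x, norm_nonneg (p t x), norm_nonneg (ψ t x)]
    have hm' := mul_le_mul hi (bs t ht x) (norm_nonneg _) (by positivity)
    rw [le_div_iff₀ hC₁]
    refine le_of_mul_le_mul_right ?_ (epos x)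
    nlinarith [br t ht x, mul_le_mul_of_nonneg_right hw (norm_nonneg (m t x))]
  have hM : ∀ t ∈ I, Integrable (fun x : ℝ => (1 - ‖ψ t x‖ ^ 2) ^ 2) := fun t ht => by
    refine ((integrable_exp_neg_mul_abs hα).const_mul (C₂ ^ 2)).mono'
      (by have := cψ t ht; exact (by fun_prop : Continuous _).aestronglyMeasurable)
      (ae_of_all _ fun x => ?_)
    have h := hdecay t ht x
    have h0 : 0 ≤ 1 - ‖ψ t x‖ ^ 2 := by nlinarith [epos x]
    rw [Real.norm_eq_abs, abs_of_nonneg (by positivity)]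
    calc (1 - ‖ψ t x‖ ^ 2) ^ 2 ≤ (C₂ * Real.exp (-α * |x|)) ^ 2 := pow_le_pow_left₀ h0 h.2 2
      _ = C₂ ^ 2 * (Real.exp (-α * |x|) * Real.exp (-α * |x|)) := by ring
      _ ≤ C₂ ^ 2 * Real.exp (-α * |x|) := by
          gcongr
          exact mul_le_of_le_one_left (epos x).le (ele x)
  have hE : ∀ t ∈ I, Integrable (fun x : ℝ => ‖p t x‖ ^ 2) := fun t ht => by
    refine ((integrable_exp_neg_mul_abs hα).const_mul (C₂ ^ 2)).mono'
      (by have := cp t ht; exact (by fun_prop : Continuous _).aestronglyMeasurable)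
      (ae_of_all _ fun x => ?_)
    rw [Real.norm_eq_abs, abs_of_nonneg (by positivity)]
    calc ‖p t x‖ ^ 2 ≤ (C₂ * Real.exp (-α * |x|)) ^ 2 :=
          pow_le_pow_left₀ (norm_nonneg _) (bp t ht x) 2
      _ = C₂ ^ 2 * (Real.exp (-α * |x|) * Real.exp (-α * |x|)) := by ring
      _ ≤ C₂ ^ 2 * Real.exp (-α * |x|) := by
          gcongr
          exact mul_le_of_le_one_left (epos x).le (ele x)
  have bI : ∀ t ∈ I, ∀ x, ∀ z : ℂ, ‖z‖ ≤ C₂ * Real.exp (-α * |x|) →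
      |4 * ⟪Complex.I * ψ t x, z⟫_ℝ| ≤ 4 * C₂ * Real.exp (-α * |x|) := fun t ht x z hz => by
    have h := abs_real_inner_le_norm (Complex.I * ψ t x) z
    rw [norm_mul, Complex.norm_I, one_mul] at h
    rw [abs_mul, abs_of_pos (by norm_num : (0 : ℝ) < 4)]
    nlinarith [hmod t ht x, norm_nonneg z, norm_nonneg (ψ t x)]
  have bP : ∀ t ∈ I, ∀ x, ∀ z : ℂ, ∀ B, ‖z‖ ≤ B →
      |2 * ⟪p t x, z⟫_ℝ| ≤ 2 * C₂ * B * Real.exp (-α * |x|) := fun t ht x z B hz => by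
    have h := abs_real_inner_le_norm (p t x) z
    have h' := mul_le_mul (bp t ht x) hz (norm_nonneg z) (by positivity)
    rw [abs_mul, abs_two]
    linarith
  refine ⟨hM, hE, ?_, ?_⟩
  · refine integral_eq_of_exp_decaying_flux hIopen hIconn
      (f := fun t x => (1 - ‖ψ t x‖ ^ 2) ^ 2)
      (g := fun t x => 4 * ⟪Complex.I * ψ t x, q t x⟫_ℝ)
      (F := fun t x => 4 * ⟪Complex.I * ψ t x, p t x⟫_ℝ) (K := 4 * C₂) hα
      (fun t ht x => ?_) (fun t ht x => ?_) hM (fun t ht => ?_)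
      (fun t ht x => bI t ht x _ (bq t ht x)) (fun t ht x => bI t ht x _ (bp t ht x))
    · have h : HasDerivAt (fun τ => 1 - ‖ψ τ x‖ ^ 2) (-(2 * ⟪ψ t x, s t x⟫_ℝ)) t :=
        (dψt t ht x).norm_sq.const_sub 1
      refine (h.pow 2).congr_deriv ?_
      have e : (1 - ‖ψ t x‖ ^ 2) * ⟪ψ t x, s t x⟫_ℝ = ⟪ψ t x, Complex.I * q t x⟫_ℝ := by
        rw [← hws t ht x, real_inner_smul_right]
      have e' : ⟪ψ t x, Complex.I * q t x⟫_ℝ = -⟪Complex.I * ψ t x, q t x⟫_ℝ := by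
        simp [Complex.inner]
        ring
      simp only [Nat.cast_ofNat, Nat.add_one_sub_one, pow_one]
      linear_combination (-4) * e - 4 * e'
    · refine ((((dψx t ht x).const_mul Complex.I).inner ℝ (dpx t ht x)).const_mul 4).congr_deriv ?_
      have e : ⟪Complex.I * p t x, p t x⟫_ℝ = 0 := by
        simp [Complex.inner]
        ring
      rw [e, add_zero]
    · have := cψ t ht
      have := cq t ht
      fun_prop
  · have bm₀ : 0 ≤ (C₂ + 2 * C₂ * (C₂ / C₁)) / C₁ := by positivity
    have bs₀ : 0 ≤ C₂ / C₁ := by positivity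
    refine integral_eq_of_exp_decaying_flux hIopen hIconn
      (f := fun t x => ‖p t x‖ ^ 2)
      (g := fun t x => 2 * ⟪p t x, m t x⟫_ℝ)
      (F := fun t x => 2 * ⟪p t x, s t x⟫_ℝ)
      (K := 2 * C₂ * ((C₂ + 2 * C₂ * (C₂ / C₁)) / C₁ + C₂ / C₁)) hα
      (fun t ht x => (dpt t ht x).norm_sq) (fun t ht x => ?_) hE (fun t ht => ?_)
      (fun t ht x => bP t ht x _ _ ((bm t ht x).trans (le_add_of_nonneg_right bs₀)))
      (fun t ht x => bP t ht x _ _ ((bs t ht x).trans (le_add_of_nonneg_left bm₀)))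
    · refine (((dpx t ht x).inner ℝ (dsx t ht x)).const_mul 2).congr_deriv ?_
      have hw : 0 < 1 - ‖ψ t x‖ ^ 2 := (mul_pos hC₁ (epos x)).trans_le (hdecay t ht x).1
      have e : (1 - ‖ψ t x‖ ^ 2) * ⟪q t x, s t x⟫_ℝ = 0 := by
        rw [← real_inner_smul_right, hws t ht x]
        simp [Complex.inner]
        ring
      rw [(mul_eq_zero.1 e).resolve_left hw.ne', add_zero]
    · have := cp t ht
      have := cm t ht
      fun_prop
end
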